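/- arXiv:0704.3937 — 2 statements merged into one kernel-verified Lean document; each statement's English description precedes it below -/
import Mathlib

section
/- Let μ be an inhomogeneous Bernoulli product on Σ with weights (p_n) ⊂ (0,1). Then its lower Hausdorff dimension dim_*(μ) = inf{ dim(E) : E Borel, μ(E) > 0 } satisfies dim_*(μ) = liminf_{n→∞} ( -τ_{μ,n}'(1) ) = -τ_μ'(1^+), where -τ_{μ,n}'(1) = (1/(n log 2)) Σ_{I∈F_n} -μ(I) log μ(I) is the n-th normalized entropy of μ. -/
open MeasureTheory Filter Set

noncomputable section

open Classical in
/-- The distance `d(x,y) = 2^{-min{n ≥ 1 : xₙ ≠ yₙ}}` on the Cantor space `{0,1}^ℕ`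
(coordinate `i : ℕ` of `x : ℕ → Bool` represents the paper's `x_{i+1}`). -/
def cantorDist (x y : ℕ → Bool) : ℝ :=
  if x ≠ y then (1 / 2 : ℝ) ^ (PiNat.firstDiff x y + 1) else 0

lemma cantorDist_eq (x y : ℕ → Bool) :
    cantorDist x y = (1 / 2) * @dist _ PiNat.dist x y := by
  unfold cantorDist
  by_cases h : x = y
  · rw [if_neg (by simpa using h), h, PiNat.dist_self, mul_zero]
  · rw [if_pos h, PiNat.dist_eq_of_ne h, pow_succ]
    ring

/-- The Cantor space `Σ = {0,1}^ℕ` equipped with the metric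
`d(x,y) = 2^{-min{n ≥ 1 : xₙ ≠ yₙ}}`; `dimH` below is the Hausdorff dimension for
this metric. -/
instance cantorMetric : MetricSpace (ℕ → Bool) where
  dist := cantorDist
  dist_self x := by simp [cantorDist]
  dist_comm x y := by
    show cantorDist x y = cantorDist y x
    rw [cantorDist_eq, cantorDist_eq, PiNat.dist_comm]
  dist_triangle x y z := by
    show cantorDist x z ≤ cantorDist x y + cantorDist y z
    rw [cantorDist_eq, cantorDist_eq, cantorDist_eq]
    have := PiNat.dist_triangle x y z
    linarith
  eq_of_dist_eq_zero := by
    intro x y h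
    replace h : cantorDist x y = 0 := h
    unfold cantorDist at h
    by_contra hxy
    rw [if_pos hxy] at h
    exact absurd h (by positivity)

/-- The generation-`n` cylinder `I_{ε₁…εₙ} = {x ∈ Σ : x₁ = ε₁, …, xₙ = εₙ}`; the
collection `F_n` of all `2^n` cylinders of generation `n` is the range of
`ε ↦ cyl ε` over `ε : Fin n → Bool`. -/
def cyl {n : ℕ} (ε : Fin n → Bool) : Set (ℕ → Bool) :=
  {x | ∀ i : Fin n, x (i : ℕ) = ε i}

/-- `μ` is the inhomogeneous Bernoulli product with weights `(pₙ)`: the Borel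
probability measure determined by `μ(I_{ε₁…εₙ}) = ∏_{j=1}^n pⱼ^{1-εⱼ} (1-pⱼ)^{εⱼ}`. -/
def IsBernoulliProduct (p : ℕ → ℝ) (μ : Measure (ℕ → Bool)) : Prop :=
  IsProbabilityMeasure μ ∧
    ∀ (n : ℕ) (ε : Fin n → Bool),
      μ (cyl ε) = ENNReal.ofReal (∏ i : Fin n, if ε i then 1 - p (i : ℕ) else p (i : ℕ))

/-- `τ_{μ,n}(q) = (1/(n log 2)) · log ∑_{I ∈ F_n} μ(I)^q`. -/
def tauN (μ : Measure (ℕ → Bool)) (n : ℕ) (q : ℝ) : ℝ :=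
  (1 / (n * Real.log 2)) * Real.log (∑ ε : Fin n → Bool, (μ (cyl ε)).toReal ^ q)

/-- The `L^q`-spectrum `τ_μ(q) = limsup_{n→∞} τ_{μ,n}(q)`. -/
def tauLq (μ : Measure (ℕ → Bool)) (q : ℝ) : ℝ :=
  limsup (fun n : ℕ => tauN μ n q) atTop


/-! ### Analytic part -/

def wgt (p : ℕ → ℝ) {n : ℕ} (ε : Fin n → Bool) : ℝ :=
  ∏ i : Fin n, if ε i then 1 - p (i : ℕ) else p (i : ℕ)

lemma wgt_pos {p : ℕ → ℝ} (hp : ∀ k, p k ∈ Set.Ioo (0 : ℝ) 1) {n : ℕ} (ε : Fin n → Bool) :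
    0 < wgt p ε := by
  apply Finset.prod_pos
  intro i _
  have := hp i
  split_ifs
  · linarith [this.2]
  · exact this.1

lemma mu_cyl {p : ℕ → ℝ} {μ : Measure (ℕ → Bool)} (hμ : IsBernoulliProduct p μ)
    {n : ℕ} (ε : Fin n → Bool) : μ (cyl ε) = ENNReal.ofReal (wgt p ε) := hμ.2 n ε

lemma mu_cyl_toReal {p : ℕ → ℝ} (hp : ∀ k, p k ∈ Set.Ioo (0 : ℝ) 1)
    {μ : Measure (ℕ → Bool)} (hμ : IsBernoulliProduct p μ)
    {n : ℕ} (ε : Fin n → Bool) : (μ (cyl ε)).toReal = wgt p ε := by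
  rw [mu_cyl hμ, ENNReal.toReal_ofReal (wgt_pos hp ε).le]

lemma sum_wgt_rpow {p : ℕ → ℝ} (hp : ∀ k, p k ∈ Set.Ioo (0 : ℝ) 1) (n : ℕ) (q : ℝ) :
    ∑ ε : Fin n → Bool, wgt p ε ^ q
      = ∏ i : Fin n, ((p i) ^ q + (1 - p i) ^ q) := by
  have h : ∀ i : Fin n, (p i) ^ q + (1 - p i) ^ q
      = ∑ b : Bool, (if b then 1 - p i else p i) ^ q := by
    intro i; simp [add_comm]
  simp_rw [h]
  rw [Finset.prod_univ_sum]
  simp only [Fintype.piFinset_univ]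
  apply Finset.sum_congr rfl
  intro ε _
  unfold wgt
  rw [Real.finsetProd_rpow]
  intro i _
  have := hp i
  split_ifs
  · linarith [this.2]
  · exact this.1.le

lemma sum_wgt {p : ℕ → ℝ} (hp : ∀ k, p k ∈ Set.Ioo (0 : ℝ) 1) (n : ℕ) :
    ∑ ε : Fin n → Bool, wgt p ε = 1 := by
  have := sum_wgt_rpow hp n 1
  simpa using this

lemma tauN_eq {p : ℕ → ℝ} (hp : ∀ k, p k ∈ Set.Ioo (0 : ℝ) 1)
    {μ : Measure (ℕ → Bool)} (hμ : IsBernoulliProduct p μ) (n : ℕ) (q : ℝ) :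
    tauN μ n q = (1 / (n * Real.log 2)) *
      ∑ i : Fin n, Real.log ((p i) ^ q + (1 - p i) ^ q) := by
  unfold tauN
  simp_rw [mu_cyl_toReal hp hμ]
  rw [sum_wgt_rpow hp, Real.log_prod]
  intro i _
  have := hp i
  have h1 := Real.rpow_pos_of_pos this.1 q
  have h2 := Real.rpow_pos_of_pos (sub_pos.2 this.2) q
  positivity

def ent (p : ℕ → ℝ) (n : ℕ) : ℝ :=
  (1 / (n * Real.log 2)) * ∑ i : Fin n, Real.binEntropy (p i)

lemma deriv_tauN {p : ℕ → ℝ} (hp : ∀ k, p k ∈ Set.Ioo (0 : ℝ) 1)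
    {μ : Measure (ℕ → Bool)} (hμ : IsBernoulliProduct p μ) (n : ℕ) :
    -deriv (tauN μ n) 1 = ent p n := by
  have h : tauN μ n = fun q => (1 / (n * Real.log 2)) *
      ∑ i : Fin n, Real.log ((p i) ^ q + (1 - p i) ^ q) := funext (tauN_eq hp hμ n)
  have hd : ∀ i : Fin n, HasDerivAt (fun q : ℝ => Real.log ((p i) ^ q + (1 - p i) ^ q))
      (-Real.binEntropy (p i)) 1 := by
    intro i
    have := hp i
    have h1 := (Real.hasStrictDerivAt_const_rpow this.1 1).hasDerivAt
    have h2 := (Real.hasStrictDerivAt_const_rpow (sub_pos.2 this.2) 1).hasDerivAt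
    have h3 := (h1.add h2).log (by simp)
    convert! h3 using 1
    simp [Real.binEntropy, Real.log_inv]
    ring
  have h4 : HasDerivAt (tauN μ n) ((1 / (n * Real.log 2)) *
      ∑ i : Fin n, -Real.binEntropy (p i)) 1 := by
    rw [h]
    exact (HasDerivAt.fun_sum (fun i _ => hd i)).const_mul _
  rw [h4.deriv, Finset.sum_neg_distrib]
  unfold ent
  ring

lemma deriv_tauN' {p : ℕ → ℝ} (hp : ∀ k, p k ∈ Set.Ioo (0 : ℝ) 1)
    {μ : Measure (ℕ → Bool)} (hμ : IsBernoulliProduct p μ) (n : ℕ) :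
    -deriv (tauN μ n) 1 = (1 / (n * Real.log 2)) *
      ∑ ε : Fin n → Bool, -(wgt p ε * Real.log (wgt p ε)) := by
  have h : tauN μ n = fun q => (1 / (n * Real.log 2)) *
      Real.log (∑ ε : Fin n → Bool, wgt p ε ^ q) := by
    funext q
    unfold tauN
    simp_rw [mu_cyl_toReal hp hμ]
  have hd : HasDerivAt (fun q : ℝ => ∑ ε : Fin n → Bool, wgt p ε ^ q)
      (∑ ε : Fin n → Bool, wgt p ε * Real.log (wgt p ε)) 1 := by
    apply HasDerivAt.fun_sum
    intro ε _
    have h1 := (Real.hasStrictDerivAt_const_rpow (wgt_pos hp ε) 1).hasDerivAt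
    simpa using h1
  have h3 := (hd.log (by simp [sum_wgt hp])).const_mul (1 / (n * Real.log 2))
  rw [h, h3.deriv, Finset.sum_neg_distrib]
  simp [sum_wgt hp]

lemma ent_nonneg {p : ℕ → ℝ} (hp : ∀ k, p k ∈ Set.Ioo (0 : ℝ) 1) (n : ℕ) : 0 ≤ ent p n := by
  unfold ent
  have := Real.log_pos one_lt_two
  have : 0 ≤ ∑ i : Fin n, Real.binEntropy (p i) :=
    Finset.sum_nonneg fun i _ => Real.binEntropy_nonneg (hp i).1.le (hp i).2.le
  positivity

lemma ent_le_one (p : ℕ → ℝ) (n : ℕ) : ent p n ≤ 1 := by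
  unfold ent
  have h2 := Real.log_pos one_lt_two
  have h : ∑ i : Fin n, Real.binEntropy (p i) ≤ n * Real.log 2 := by
    calc _ ≤ ∑ i : Fin n, Real.log 2 := Finset.sum_le_sum fun i _ => Real.binEntropy_le_log_two
      _ = _ := by simp
  rcases Nat.eq_zero_or_pos n with rfl | hn
  · simp
  · have : (0 : ℝ) < n := by exact_mod_cast hn
    rw [one_div_mul_eq_div, div_le_one (by positivity)]
    exact h

lemma exp_neg_le {z : ℝ} (hz : 0 ≤ z) : Real.exp (-z) ≤ 1 - z + z ^ 2 / 2 := by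
  have h := Real.quadratic_le_exp_of_nonneg hz
  rw [Real.exp_neg, inv_le_iff_one_le_mul₀ (Real.exp_pos z)]
  have h0 : 0 ≤ 1 - z + z ^ 2 / 2 := by nlinarith [sq_nonneg (z - 1)]
  have := mul_le_mul_of_nonneg_left h h0
  nlinarith [pow_nonneg hz 4]

lemma mul_rpow_le {a t : ℝ} (ha : 0 < a) (ha1 : a < 1) (ht : 0 ≤ t) :
    a ^ (1 + t) ≤ a + t * (a * Real.log a) + t ^ 2 := by
  have hl := Real.log_neg ha ha1
  have h1 : a ^ (1 + t) = a * Real.exp (-(t * -Real.log a)) := by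
    rw [Real.rpow_add ha, Real.rpow_one, Real.rpow_def_of_pos ha]
    congr 2; ring
  rw [h1]
  have h2 := mul_le_mul_of_nonneg_left
    (exp_neg_le (mul_nonneg ht (neg_nonneg.2 hl.le))) ha.le
  have h3 : a * (Real.log a) ^ 2 ≤ 2 := by
    have h := Real.quadratic_le_exp_of_nonneg (neg_nonneg.2 hl.le)
    rw [Real.exp_neg, Real.exp_log ha] at h
    have h4 := mul_le_mul_of_nonneg_left h ha.le
    rw [mul_inv_cancel₀ ha.ne'] at h4
    nlinarith
  nlinarith [mul_le_mul_of_nonneg_left h3 (sq_nonneg t)]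

lemma log_upper {a t : ℝ} (ha : a ∈ Set.Ioo (0 : ℝ) 1) (ht : 0 ≤ t) :
    Real.log (a ^ (1 + t) + (1 - a) ^ (1 + t)) ≤ -t * Real.binEntropy a + 2 * t ^ 2 := by
  have h1 := mul_rpow_le ha.1 ha.2 ht
  have h2 := mul_rpow_le (sub_pos.2 ha.2) (by linarith [ha.1]) ht
  have hpos : 0 < a ^ (1 + t) + (1 - a) ^ (1 + t) :=
    add_pos (Real.rpow_pos_of_pos ha.1 _) (Real.rpow_pos_of_pos (sub_pos.2 ha.2) _)
  have h3 := Real.log_le_sub_one_of_pos hpos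
  simp only [Real.binEntropy, Real.log_inv]
  nlinarith

lemma log_lower {a t : ℝ} (ha : a ∈ Set.Ioo (0 : ℝ) 1) :
    -t * Real.binEntropy a ≤ Real.log (a ^ (1 + t) + (1 - a) ^ (1 + t)) := by
  have hb : 0 < 1 - a := sub_pos.2 ha.2
  have h := Real.geom_mean_le_arith_mean2_weighted ha.1.le hb.le
    (Real.rpow_pos_of_pos ha.1 t).le (Real.rpow_pos_of_pos hb t).le (by ring)
  have hpa := Real.rpow_pos_of_pos ha.1 t
  have hpb := Real.rpow_pos_of_pos hb t
  have hpa' := Real.rpow_pos_of_pos hpa a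
  have hpb' := Real.rpow_pos_of_pos hpb (1 - a)
  rw [Real.rpow_add ha.1, Real.rpow_add hb, Real.rpow_one, Real.rpow_one]
  refine le_trans (le_of_eq ?_) (Real.log_le_log (mul_pos hpa' hpb') h)
  rw [Real.log_mul hpa'.ne' hpb'.ne', Real.log_rpow hpa, Real.log_rpow hpb,
    Real.log_rpow ha.1, Real.log_rpow hb]
  simp only [Real.binEntropy, Real.log_inv]
  ring

lemma tauN_upper {p : ℕ → ℝ} (hp : ∀ k, p k ∈ Set.Ioo (0 : ℝ) 1)
    {μ : Measure (ℕ → Bool)} (hμ : IsBernoulliProduct p μ) (n : ℕ) {t : ℝ} (ht : 0 ≤ t) :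
    tauN μ n (1 + t) ≤ -t * ent p n + 2 / Real.log 2 * t ^ 2 := by
  have h2 := Real.log_pos one_lt_two
  rw [tauN_eq hp hμ]
  have h : ∑ i : Fin n, Real.log ((p i) ^ (1 + t) + (1 - p i) ^ (1 + t))
      ≤ -t * ∑ i : Fin n, Real.binEntropy (p i) + n * (2 * t ^ 2) := by
    calc _ ≤ ∑ i : Fin n, (-t * Real.binEntropy (p i) + 2 * t ^ 2) :=
          Finset.sum_le_sum fun i _ => log_upper (hp i) ht
      _ = _ := by rw [Finset.sum_add_distrib, Finset.mul_sum]; simp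
  unfold ent
  rcases Nat.eq_zero_or_pos n with rfl | hn
  · simp; positivity
  · have hn' : (0 : ℝ) < n := by exact_mod_cast hn
    have := mul_le_mul_of_nonneg_left h (by positivity : 0 ≤ 1 / (n * Real.log 2))
    refine this.trans (le_of_eq ?_)
    field_simp

lemma tauN_lower {p : ℕ → ℝ} (hp : ∀ k, p k ∈ Set.Ioo (0 : ℝ) 1)
    {μ : Measure (ℕ → Bool)} (hμ : IsBernoulliProduct p μ) (n : ℕ) (t : ℝ) :
    -t * ent p n ≤ tauN μ n (1 + t) := by
  have h2 := Real.log_pos one_lt_two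
  rw [tauN_eq hp hμ]
  have h : -t * ∑ i : Fin n, Real.binEntropy (p i) ≤
      ∑ i : Fin n, Real.log ((p i) ^ (1 + t) + (1 - p i) ^ (1 + t)) := by
    rw [Finset.mul_sum]
    exact Finset.sum_le_sum fun i _ => log_lower (hp i)
  have := mul_le_mul_of_nonneg_left h (by positivity : 0 ≤ 1 / (n * Real.log 2))
  refine le_trans (le_of_eq ?_) this
  unfold ent
  ring

lemma ent_bdd_below {p : ℕ → ℝ} (hp : ∀ k, p k ∈ Set.Ioo (0 : ℝ) 1) :
    IsBoundedUnder (· ≥ ·) atTop (ent p) :=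
  isBoundedUnder_of ⟨0, fun n => ent_nonneg hp n⟩

lemma ent_cobdd (p : ℕ → ℝ) :
    IsCoboundedUnder (· ≥ ·) atTop (ent p) :=
  (isBoundedUnder_of ⟨1, fun n => ent_le_one p n⟩ :
    IsBoundedUnder (· ≤ ·) atTop (ent p)).isCoboundedUnder_ge

lemma liminf_ent_nonneg {p : ℕ → ℝ} (hp : ∀ k, p k ∈ Set.Ioo (0 : ℝ) 1) :
    0 ≤ liminf (ent p) atTop :=
  le_liminf_of_le (ent_cobdd p) (Eventually.of_forall (ent_nonneg hp))

lemma tauLq_bounds {p : ℕ → ℝ} (hp : ∀ k, p k ∈ Set.Ioo (0 : ℝ) 1)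
    {μ : Measure (ℕ → Bool)} (hμ : IsBernoulliProduct p μ) {t : ℝ} (ht : 0 ≤ t) :
    -t * liminf (ent p) atTop ≤ tauLq μ (1 + t) ∧
    tauLq μ (1 + t) ≤ -t * liminf (ent p) atTop + 2 / Real.log 2 * t ^ 2 := by
  have h2 := Real.log_pos one_lt_two
  have hub : IsBoundedUnder (· ≤ ·) atTop (fun n => tauN μ n (1 + t)) := by
    refine isBoundedUnder_of ⟨2 / Real.log 2 * t ^ 2, fun n => ?_⟩
    have := tauN_upper hp hμ n ht
    have h3 := mul_nonneg ht (ent_nonneg hp n)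
    show _ ≤ _
    linarith
  have hlb : IsBoundedUnder (· ≥ ·) atTop (fun n => tauN μ n (1 + t)) := by
    refine isBoundedUnder_of ⟨-t, fun n => ?_⟩
    have := tauN_lower hp hμ n t
    have h3 := mul_le_mul_of_nonneg_left (ent_le_one p n) ht
    show _ ≤ _
    linarith
  constructor
  · apply le_of_forall_pos_le_add
    intro δ hδ
    have hlt : liminf (ent p) atTop < liminf (ent p) atTop + δ / (t + 1) := by
      have : 0 < δ / (t + 1) := by positivity
      linarith
    have hf := frequently_lt_of_liminf_lt (ent_cobdd p) hlt
    have : -t * (liminf (ent p) atTop + δ / (t + 1)) ≤ tauLq μ (1 + t) := by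
      apply le_limsup_of_frequently_le _ hub
      refine hf.mono fun n hn => ?_
      refine le_trans ?_ (tauN_lower hp hμ n t)
      nlinarith
    have h4 : t * (δ / (t + 1)) ≤ δ := by
      rw [← mul_div_assoc, div_le_iff₀ (by positivity)]; nlinarith
    nlinarith
  · apply le_of_forall_pos_le_add
    intro δ hδ
    have hlt : liminf (ent p) atTop - δ / (t + 1) < liminf (ent p) atTop := by
      have : 0 < δ / (t + 1) := by positivity
      linarith
    have hf := eventually_lt_of_lt_liminf hlt (ent_bdd_below hp)
    have : tauLq μ (1 + t) ≤ -t * (liminf (ent p) atTop - δ / (t + 1)) +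
        2 / Real.log 2 * t ^ 2 := by
      apply limsup_le_of_le hlb.isCoboundedUnder_le
      refine hf.mono fun n hn => ?_
      refine le_trans (tauN_upper hp hμ n ht) ?_
      nlinarith
    have h4 : t * (δ / (t + 1)) ≤ δ := by
      rw [← mul_div_assoc, div_le_iff₀ (by positivity)]; nlinarith
    nlinarith

lemma hasDeriv_tauLq {p : ℕ → ℝ} (hp : ∀ k, p k ∈ Set.Ioo (0 : ℝ) 1)
    {μ : Measure (ℕ → Bool)} (hμ : IsBernoulliProduct p μ) :
    HasDerivWithinAt (tauLq μ) (-liminf (ent p) atTop) (Set.Ioi (1 : ℝ)) 1 := by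
  have h1 : tauLq μ 1 = 0 := by
    have := tauLq_bounds hp hμ (le_refl (0 : ℝ))
    simp at this
    linarith [this.1, this.2]
  have h2 := Real.log_pos one_lt_two
  rw [hasDerivWithinAt_iff_isLittleO, h1]
  have hO : (fun x' => tauLq μ x' - 0 - (x' - 1) • -liminf (ent p) atTop)
      =O[nhdsWithin 1 (Ioi 1)] fun x' : ℝ => (x' - 1) ^ 2 := by
    refine Asymptotics.IsBigO.of_bound (2 / Real.log 2) ?_
    filter_upwards [self_mem_nhdsWithin] with x hx
    have hx' : (0 : ℝ) ≤ x - 1 := sub_nonneg.2 (le_of_lt hx)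
    have := tauLq_bounds hp hμ hx'
    rw [add_sub_cancel] at this
    rw [Real.norm_of_nonneg (sq_nonneg (x - 1)), Real.norm_eq_abs, abs_le, smul_eq_mul]
    constructor
    · have : 0 ≤ 2 / Real.log 2 * (x - 1) ^ 2 := by positivity
      linarith
    · linarith
  refine hO.trans_isLittleO ?_
  have h3 : (fun x' : ℝ => (x' - 1) ^ 2) =o[nhds 1] fun x' => x' - 1 := by
    have := Asymptotics.isLittleO_pow_sub_sub (1 : ℝ) (m := 2) (by norm_num)
    simpa using this
  exact h3.mono nhdsWithin_le_nhds

/-! ### Geometric part -/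

def pre (x : ℕ → Bool) (n : ℕ) : Fin n → Bool := fun i => x i

lemma mem_cyl_pre (x y : ℕ → Bool) (n : ℕ) : y ∈ cyl (pre x n) ↔ ∀ i < n, y i = x i := by
  simp only [cyl, pre, Set.mem_ofPred_eq]
  exact ⟨fun h i hi => h ⟨i, hi⟩, fun h i => h i i.2⟩

lemma mem_cyl_pre_self (x : ℕ → Bool) (n : ℕ) : x ∈ cyl (pre x n) := fun _ => rfl

lemma pre_eq_of_mem {n : ℕ} {ε : Fin n → Bool} {x : ℕ → Bool} (h : x ∈ cyl ε) : pre x n = ε :=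
  funext h

lemma cdist_eq (x y : ℕ → Bool) : dist x y = cantorDist x y := rfl

lemma cantorDist_le_iff (x y : ℕ → Bool) (n : ℕ) :
    dist x y ≤ (1 / 2 : ℝ) ^ (n + 1) ↔ ∀ i < n, y i = x i := by
  rw [cdist_eq]
  unfold cantorDist
  by_cases h : x = y
  · subst h; simp
  · rw [if_pos h, pow_le_pow_iff_right_of_lt_one₀ (by norm_num) (by norm_num)]
    constructor
    · intro hn i hi
      exact (PiNat.apply_eq_of_lt_firstDiff (by omega)).symm
    · intro hh
      by_contra hc
      exact PiNat.apply_firstDiff_ne h (hh _ (by omega)).symm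

lemma measurableSet_cyl {n : ℕ} (ε : Fin n → Bool) : MeasurableSet (cyl ε) := by
  have : cyl ε = ⋂ i : Fin n, (fun x : ℕ → Bool => x i) ⁻¹' {ε i} := by
    ext x; simp [cyl]
  rw [this]
  exact MeasurableSet.iInter fun i => measurable_pi_apply _ (measurableSet_singleton _)

lemma cantor_isOpen_iff (U : Set (ℕ → Bool)) :
    @IsOpen _ cantorMetric.toPseudoMetricSpace.toUniformSpace.toTopologicalSpace U ↔
      ∀ x ∈ U, ∃ n, cyl (pre x n) ⊆ U := by
  rw [Metric.isOpen_iff]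
  refine forall₂_congr fun x _ => ?_
  constructor
  · rintro ⟨e, he, h⟩
    obtain ⟨n, hn⟩ := exists_pow_lt_of_lt_one he (by norm_num : (1 / 2 : ℝ) < 1)
    refine ⟨n, fun y hy => h ?_⟩
    rw [mem_cyl_pre] at hy
    have := (cantorDist_le_iff x y n).2 hy
    rw [Metric.mem_ball, dist_comm]
    refine lt_of_le_of_lt this (lt_of_le_of_lt ?_ hn)
    exact pow_le_pow_of_le_one (by norm_num) (by norm_num) (Nat.le_succ n)
  · rintro ⟨n, h⟩
    refine ⟨(1 / 2) ^ (n + 1), by positivity, fun y hy => h ?_⟩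
    rw [Metric.mem_ball, dist_comm] at hy
    rw [mem_cyl_pre]
    exact (cantorDist_le_iff x y n).1 hy.le

lemma cantor_borel : @BorelSpace (ℕ → Bool)
    cantorMetric.toPseudoMetricSpace.toUniformSpace.toTopologicalSpace MeasurableSpace.pi := by
  let tt : TopologicalSpace (ℕ → Bool) :=
    cantorMetric.toPseudoMetricSpace.toUniformSpace.toTopologicalSpace
  refine @BorelSpace.mk _ tt MeasurableSpace.pi (le_antisymm ?_ ?_)
  · refine iSup_le fun i => ?_
    rw [MeasurableSpace.comap_le_iff_le_map]
    intro s _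
    apply MeasurableSpace.measurableSet_generateFrom
    refine (cantor_isOpen_iff _).2 ?_
    intro x hx
    refine ⟨i + 1, fun y hy => ?_⟩
    rw [mem_cyl_pre] at hy
    have := hy i (by omega)
    simp only [Set.mem_preimage] at hx ⊢
    rwa [this]
  · refine MeasurableSpace.generateFrom_le fun U hU => ?_
    have hU' := (cantor_isOpen_iff U).1 hU
    have : U = ⋃ (n : ℕ) (ε : Fin n → Bool) (_ : cyl ε ⊆ U), cyl ε := by
      ext x
      simp only [Set.mem_iUnion, exists_prop]
      constructor
      · intro hx
        obtain ⟨n, hn⟩ := hU' x hx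
        exact ⟨n, _, hn, mem_cyl_pre_self x n⟩
      · rintro ⟨n, ε, h, hx⟩
        exact h hx
    rw [this]
    exact MeasurableSet.iUnion fun n => MeasurableSet.iUnion fun ε =>
      MeasurableSet.iUnion fun _ => measurableSet_cyl ε

lemma ediam_cyl {n : ℕ} (ε : Fin n → Bool) :
    Metric.ediam (cyl ε) ≤ ENNReal.ofReal ((1 / 2) ^ (n + 1)) := by
  apply Metric.ediam_le
  intro x hx y hy
  rw [edist_dist]
  apply ENNReal.ofReal_le_ofReal
  rw [cantorDist_le_iff]
  intro i hi
  have h1 := hx ⟨i, hi⟩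
  have h2 := hy ⟨i, hi⟩
  simp only at h1 h2
  rw [h1, h2]

/-- mass distribution principle -/
lemma massDist (μ : Measure (ℕ → Bool)) {s : ℝ} (hs : 0 < s) {E : Set (ℕ → Bool)}
    (hE : MeasurableSet E) (hμE : 0 < μ E) (m : ℕ)
    (h : ∀ x ∈ E, ∀ n ≥ m, μ (cyl (pre x n)) ≤ ENNReal.ofReal (((1 / 2 : ℝ) ^ n) ^ s)) :
    ENNReal.ofReal s ≤ dimH E := by
  have := cantor_borel
  set C : ENNReal := ENNReal.ofReal ((4 : ℝ) ^ s) with hC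
  have hC0 : C ≠ 0 := by
    rw [hC]; simp; positivity
  have hCt : C ≠ ⊤ := ENNReal.ofReal_ne_top
  have key : (C⁻¹ • μ.restrict E) ≤ Measure.hausdorffMeasure s := by
    apply Measure.le_hausdorffMeasure s _ (ENNReal.ofReal ((1 / 2) ^ (m + 1)))
    · simp
    intro U hU
    rw [Measure.smul_apply, Measure.restrict_apply' hE, smul_eq_mul, mul_comm,
      ← div_eq_mul_inv, ENNReal.div_le_iff_le_mul (Or.inl hC0) (Or.inl hCt), mul_comm]
    rcases Set.eq_empty_or_nonempty (U ∩ E) with hemp | ⟨x, hxU, hxE⟩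
    · simp [hemp]
    have hfin : Metric.ediam U ≠ ⊤ := ne_top_of_le_ne_top ENNReal.ofReal_ne_top hU
    have hsub : ∀ n : ℕ, Metric.ediam U ≤ ENNReal.ofReal ((1 / 2) ^ (n + 1)) →
        U ∩ E ⊆ cyl (pre x n) := by
      intro n hn y hy
      rw [mem_cyl_pre, ← cantorDist_le_iff]
      have := (Metric.edist_le_ediam_of_mem hxU hy.1).trans hn
      rwa [edist_dist, ENNReal.ofReal_le_ofReal_iff (by positivity)] at this
    by_cases h0 : Metric.ediam U = 0
    · have hz : μ (U ∩ E) ≤ 0 := by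
        have ht : Tendsto (fun n : ℕ => ENNReal.ofReal (((1 / 2 : ℝ) ^ n) ^ s)) atTop (nhds 0) := by
          rw [← ENNReal.ofReal_zero]
          apply ENNReal.tendsto_ofReal
          have h1 := tendsto_pow_atTop_nhds_zero_of_lt_one (r := (1 / 2 : ℝ)) (by norm_num)
            (by norm_num)
          have h2 := h1.rpow_const (p := s) (Or.inr hs.le)
          rwa [Real.zero_rpow hs.ne'] at h2
        refine ge_of_tendsto ht ?_
        filter_upwards [eventually_ge_atTop m] with n hn
        exact (measure_mono (hsub n (by simp [h0]))).trans (h x hxE n hn)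
      exact hz.trans zero_le
    · set r := (Metric.ediam U).toReal with hr
      have hr0 : 0 < r := ENNReal.toReal_pos h0 hfin
      have hUr : Metric.ediam U = ENNReal.ofReal r := (ENNReal.ofReal_toReal hfin).symm
      rw [hUr, ENNReal.ofReal_le_ofReal_iff (by positivity), pow_succ] at hU
      have hp1 : (1 / 2 : ℝ) ^ m ≤ 1 := pow_le_one₀ (by norm_num) (by norm_num)
      obtain ⟨n, hn1, hn2⟩ := exists_nat_pow_near_of_lt_one (x := 2 * r) (y := (1 / 2 : ℝ))
        (by positivity) (by linarith) (by norm_num) (by norm_num)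
      have hnm : m ≤ n := by
        by_contra hc
        have : (1 / 2 : ℝ) ^ m ≤ (1 / 2) ^ (n + 1) :=
          pow_le_pow_of_le_one (by norm_num) (by norm_num) (by omega)
        linarith
      have h1 := measure_mono (μ := μ) (hsub n (by
        rw [hUr]; apply ENNReal.ofReal_le_ofReal; rw [pow_succ]; linarith))
      refine h1.trans ((h x hxE n hnm).trans ?_)
      rw [hUr, ENNReal.ofReal_rpow_of_nonneg hr0.le hs.le, hC,
        ← ENNReal.ofReal_mul (by positivity)]
      apply ENNReal.ofReal_le_ofReal
      rw [← Real.mul_rpow (by norm_num) hr0.le]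
      apply Real.rpow_le_rpow (by positivity) _ hs.le
      rw [pow_succ] at hn1
      linarith
  have hne : Measure.hausdorffMeasure s E ≠ 0 := by
    intro hz
    have h1 := key E
    rw [hz, Measure.smul_apply, Measure.restrict_apply' hE, Set.inter_self, smul_eq_mul] at h1
    have : C⁻¹ * μ E ≠ 0 := mul_ne_zero (ENNReal.inv_ne_zero.2 hCt) hμE.ne'
    exact this (le_antisymm h1 zero_le)
  have : Measure.hausdorffMeasure ((s.toNNReal : NNReal) : ℝ) E ≠ 0 := by
    rwa [Real.coe_toNNReal s hs.le]
  exact le_dimH_of_hausdorffMeasure_ne_zero this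

/-- covering bound -/
lemma dimH_cover (W : ∀ n : ℕ, (Fin n → Bool) → ℝ) (hW0 : ∀ n ε, 0 ≤ W n ε)
    (hW : ∀ n, ∑ ε, W n ε = 1) {s u : ℝ} (hs : 0 ≤ s) (hsu : s < u) {E : Set (ℕ → Bool)}
    (hE : ∀ x ∈ E, ∃ᶠ n in atTop, ((1 / 2 : ℝ) ^ n) ^ s ≤ W n (pre x n)) :
    dimH E ≤ ENNReal.ofReal u := by
  classical
  have := cantor_borel
  have hu : 0 < u := lt_of_le_of_lt hs hsu
  set c : ℝ := (1 / 2 : ℝ) ^ (u - s) with hc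
  have hc0 : 0 < c := by positivity
  have hc1 : c < 1 := Real.rpow_lt_one (by norm_num) (by norm_num) (by linarith)
  let T : ∀ n : ℕ, (Fin n → Bool) → Set (ℕ → Bool) := fun n ε =>
    if ((1 / 2 : ℝ) ^ n) ^ s ≤ W n ε then cyl ε else ∅
  have hTd : ∀ n ε, Metric.ediam (T n ε) ≤ ENNReal.ofReal ((1 / 2) ^ n) := by
    intro n ε
    simp only [T]
    split_ifs
    · refine (ediam_cyl ε).trans (ENNReal.ofReal_le_ofReal ?_)
      exact pow_le_pow_of_le_one (by norm_num) (by norm_num) (Nat.le_succ n)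
    · simp
  have hTu : ∀ n ε, Metric.ediam (T n ε) ^ u ≤ ENNReal.ofReal (W n ε * c ^ n) := by
    intro n ε
    by_cases hg : ((1 / 2 : ℝ) ^ n) ^ s ≤ W n ε
    · refine (ENNReal.rpow_le_rpow (hTd n ε) hu.le).trans ?_
      rw [ENNReal.ofReal_rpow_of_nonneg (by positivity) hu.le]
      apply ENNReal.ofReal_le_ofReal
      have : ((1 / 2 : ℝ) ^ n) ^ u = ((1 / 2 : ℝ) ^ n) ^ s * c ^ n := by
        rw [hc, ← Real.rpow_natCast, ← Real.rpow_natCast, ← Real.rpow_mul (by norm_num),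
          ← Real.rpow_mul (by norm_num), ← Real.rpow_mul (by norm_num),
          ← Real.rpow_add (by norm_num)]
        congr 1; ring
      rw [this]
      exact mul_le_mul_of_nonneg_right hg (by positivity)
    · have hT : T n ε = ∅ := if_neg hg
      rw [hT, Metric.ediam_empty, ENNReal.zero_rpow_of_pos hu]
      exact zero_le
  have hle : Measure.hausdorffMeasure u E ≤ 0 := by
    have hr : Tendsto (fun n : ℕ => ENNReal.ofReal ((1 / 2 : ℝ) ^ n)) atTop (nhds 0) := by
      rw [← ENNReal.ofReal_zero]
      apply ENNReal.tendsto_ofReal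
      exact tendsto_pow_atTop_nhds_zero_of_lt_one (by norm_num) (by norm_num)
    have h1 := Measure.hausdorffMeasure_le_liminf_tsum (β := ℕ)
      (ι := fun m => Σ k : ℕ, (Fin (k + m) → Bool)) u E (l := atTop)
      (fun n : ℕ => ENNReal.ofReal ((1 / 2 : ℝ) ^ n)) hr
      (fun m i => T (i.1 + m) i.2)
      (Eventually.of_forall fun m i => (hTd _ _).trans (ENNReal.ofReal_le_ofReal
        (pow_le_pow_of_le_one (by norm_num) (by norm_num) (Nat.le_add_left m i.1))))
      (Eventually.of_forall fun m x hx => by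
        obtain ⟨n, hn, hg⟩ := frequently_atTop.1 (hE x hx) m
        obtain ⟨k, rfl⟩ := Nat.exists_eq_add_of_le' hn
        refine Set.mem_iUnion.2 ⟨⟨k, pre x (k + m)⟩, ?_⟩
        simp only [T, if_pos hg]
        exact mem_cyl_pre_self x _)
    refine h1.trans ?_
    have hsum : ∑' i : ℕ, ENNReal.ofReal (c ^ i) ≠ ⊤ := by
      have := summable_geometric_of_lt_one hc0.le hc1
      exact this.tsum_ofReal_ne_top
    have h2 := ENNReal.tendsto_sum_nat_add (fun i : ℕ => ENNReal.ofReal (c ^ i)) hsum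
    rw [← h2.liminf_eq]
    refine liminf_le_liminf (Eventually.of_forall fun m => ?_)
    show (∑' i : Σ k : ℕ, (Fin (k + m) → Bool), Metric.ediam (T (i.1 + m) i.2) ^ u) ≤ _
    rw [ENNReal.tsum_sigma']
    refine ENNReal.tsum_le_tsum fun k => ?_
    rw [tsum_fintype]
    refine (Finset.sum_le_sum fun ε _ => hTu (k + m) ε).trans ?_
    rw [← ENNReal.ofReal_sum_of_nonneg, ← Finset.sum_mul, hW, one_mul]
    intro ε _
    exact mul_nonneg (hW0 _ _) (by positivity)
  have : Measure.hausdorffMeasure ((u.toNNReal : NNReal) : ℝ) E ≠ ⊤ := by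
    rw [Real.coe_toNNReal u hu.le, le_antisymm hle zero_le]
    simp
  exact dimH_le_of_hausdorffMeasure_ne_top this

lemma measurableSet_pre {n : ℕ} (G : (Fin n → Bool) → Prop) :
    MeasurableSet {x : ℕ → Bool | G (pre x n)} := by
  have : {x : ℕ → Bool | G (pre x n)} = ⋃ (ε : Fin n → Bool) (_ : G ε), cyl ε := by
    ext x
    simp only [Set.mem_ofPred_eq, Set.mem_iUnion, exists_prop]
    constructor
    · intro h; exact ⟨_, h, mem_cyl_pre_self x n⟩
    · rintro ⟨ε, h, hx⟩; rwa [pre_eq_of_mem hx]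
  rw [this]
  exact MeasurableSet.iUnion fun ε => MeasurableSet.iUnion fun _ => measurableSet_cyl ε

lemma measure_pre_le {p : ℕ → ℝ} {μ : Measure (ℕ → Bool)} (hμ : IsBernoulliProduct p μ) {n : ℕ}
    (G : (Fin n → Bool) → Prop) (f : (Fin n → Bool) → ℝ) (hf0 : ∀ ε, 0 ≤ f ε)
    (hf : ∀ ε, G ε → wgt p ε ≤ f ε) :
    μ {x : ℕ → Bool | G (pre x n)} ≤ ENNReal.ofReal (∑ ε, f ε) := by
  classical
  have : {x : ℕ → Bool | G (pre x n)} ⊆ ⋃ (ε : Fin n → Bool), if G ε then cyl ε else ∅ := by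
    intro x hx
    refine Set.mem_iUnion.2 ⟨pre x n, ?_⟩
    have hx' : G (pre x n) := hx
    rw [if_pos hx']
    exact mem_cyl_pre_self x n
  refine (measure_mono this).trans ((measure_iUnion_fintype_le _ _).trans ?_)
  rw [ENNReal.ofReal_sum_of_nonneg fun ε _ => hf0 ε]
  refine Finset.sum_le_sum fun ε _ => ?_
  split_ifs with h
  · rw [mu_cyl hμ]; exact ENNReal.ofReal_le_ofReal (hf ε h)
  · simp

lemma half_pow_rpow (n : ℕ) (s : ℝ) :
    ((1 / 2 : ℝ) ^ n) ^ s = Real.exp (-(n * s * Real.log 2)) := by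
  rw [Real.rpow_def_of_pos (by positivity), Real.log_pow, one_div, Real.log_inv]
  congr 1; ring

lemma lower_bound {p : ℕ → ℝ} (hp : ∀ k, p k ∈ Set.Ioo (0 : ℝ) 1)
    {μ : Measure (ℕ → Bool)} (hμ : IsBernoulliProduct p μ) {s : ℝ} (hs : 0 < s)
    (hsL : s < liminf (ent p) atTop) {E : Set (ℕ → Bool)} (hE : MeasurableSet E)
    (hE0 : 0 < μ E) : ENNReal.ofReal s ≤ dimH E := by
  have h2 := Real.log_pos one_lt_two
  obtain ⟨s', hss', hs'L⟩ := exists_between hsL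
  obtain ⟨δ, hδ⟩ : ∃ δ, δ = s' - s := ⟨_, rfl⟩
  have hδ0 : 0 < δ := by linarith
  obtain ⟨t, ht⟩ : ∃ t, t = δ * Real.log 2 / 4 := ⟨_, rfl⟩
  have ht0 : 0 < t := by rw [ht]; positivity
  obtain ⟨c, hc⟩ : ∃ c, c = Real.exp (-(t * (δ / 2) * Real.log 2)) := ⟨_, rfl⟩
  have hc0 : 0 < c := by rw [hc]; positivity
  have hc1 : c < 1 := by
    rw [hc, Real.exp_lt_one_iff]
    have : 0 < t * (δ / 2) * Real.log 2 := by positivity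
    linarith
  let B : ℕ → Set (ℕ → Bool) := fun n => {x | ((1 / 2 : ℝ) ^ n) ^ s < wgt p (pre x n)}
  have hBm : ∀ n, MeasurableSet (B n) := fun n =>
    measurableSet_pre (fun ε => ((1 / 2 : ℝ) ^ n) ^ s < wgt p ε)
  have hev : ∀ᶠ n in atTop, μ (B n) ≤ ENNReal.ofReal (c ^ n) := by
    filter_upwards [eventually_lt_of_lt_liminf hs'L (ent_bdd_below hp), eventually_ge_atTop 1]
      with n hn hn1
    have hn0 : (0 : ℝ) < n := by exact_mod_cast hn1
    have hb := measure_pre_le hμ (n := n) (fun ε => ((1 / 2 : ℝ) ^ n) ^ s < wgt p ε)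
      (fun ε => wgt p ε ^ (1 + t) * Real.exp (n * s * t * Real.log 2))
      (fun ε => mul_nonneg (Real.rpow_nonneg (wgt_pos hp ε).le _) (Real.exp_pos _).le)
      (fun ε hε => by
        have hw := wgt_pos hp ε
        rw [half_pow_rpow, ← Real.lt_log_iff_exp_lt hw] at hε
        rw [Real.rpow_add hw, Real.rpow_one, mul_assoc, Real.rpow_def_of_pos hw, ← Real.exp_add]
        refine le_mul_of_one_le_right hw.le (Real.one_le_exp ?_)
        nlinarith)
    refine hb.trans (ENNReal.ofReal_le_ofReal ?_)
    rw [← Finset.sum_mul]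
    have hpos : 0 < ∑ ε : Fin n → Bool, wgt p ε ^ (1 + t) :=
      Finset.sum_pos (fun ε _ => Real.rpow_pos_of_pos (wgt_pos hp ε) _) Finset.univ_nonempty
    have htau := tauN_upper hp hμ n ht0.le
    unfold tauN at htau
    simp_rw [mu_cyl_toReal hp hμ] at htau
    rw [one_div_mul_eq_div, div_le_iff₀ (by positivity)] at htau
    rw [← Real.exp_log hpos, ← Real.exp_add, hc, ← Real.exp_nat_mul, Real.exp_le_exp]
    have hK : 2 / Real.log 2 * t ^ 2 = t * (δ / 2) := by
      rw [ht]; field_simp; ring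
    rw [hK] at htau
    have h5 : -t * ent p n ≤ -t * s' := by nlinarith
    have h6 : (-t * ent p n + t * (δ / 2)) * (n * Real.log 2)
        ≤ (-t * s' + t * (δ / 2)) * (n * Real.log 2) :=
      mul_le_mul_of_nonneg_right (by linarith) (by positivity)
    refine (add_le_add_left (htau.trans h6) _).trans (le_of_eq ?_)
    rw [hδ]; ring
  obtain ⟨N, hN⟩ := eventually_atTop.1 hev
  have hsum : ∑' n, μ (B (n + N)) ≠ ⊤ := by
    have h1 : Summable (fun n : ℕ => c ^ (n + N)) :=
      (summable_nat_add_iff N).2 (summable_geometric_of_lt_one hc0.le hc1)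
    exact ne_top_of_le_ne_top h1.tsum_ofReal_ne_top
      (ENNReal.tsum_le_tsum fun n => hN (n + N) (Nat.le_add_left _ _))
  have hae := ae_eventually_notMem hsum
  let F : ℕ → Set (ℕ → Bool) := fun m => E ∩ ⋂ (n : ℕ) (_ : m ≤ n), (B n)ᶜ
  have hFm : ∀ m, MeasurableSet (F m) := fun m =>
    hE.inter (MeasurableSet.iInter fun n => MeasurableSet.iInter fun _ => (hBm n).compl)
  have hEF : μ E ≤ μ (⋃ m, F m) := by
    apply measure_mono_ae
    filter_upwards [hae] with x hx hxE
    obtain ⟨m, hm⟩ := eventually_atTop.1 hx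
    refine Set.mem_iUnion.2 ⟨m + N, hxE, ?_⟩
    simp only [Set.mem_iInter]
    intro n hn
    have := hm (n - N) (by omega)
    rwa [Nat.sub_add_cancel (by omega)] at this
  obtain ⟨m, hm⟩ : ∃ m, 0 < μ (F m) := by
    by_contra hcon
    push Not at hcon
    have : μ (⋃ m, F m) = 0 := measure_iUnion_null fun m => le_antisymm (hcon m) zero_le
    rw [this] at hEF
    exact absurd hE0 (not_lt.2 hEF)
  refine (massDist μ hs (hFm m) hm m ?_).trans (dimH_mono Set.inter_subset_left)
  rintro x ⟨_, hx⟩ n hn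
  simp only [Set.mem_iInter] at hx
  have := hx n hn
  rw [mu_cyl hμ]
  exact ENNReal.ofReal_le_ofReal (not_lt.1 this)

lemma upper_bound {p : ℕ → ℝ} (hp : ∀ k, p k ∈ Set.Ioo (0 : ℝ) 1)
    {μ : Measure (ℕ → Bool)} (hμ : IsBernoulliProduct p μ) {u : ℝ}
    (huL : liminf (ent p) atTop < u) :
    ∃ E : Set (ℕ → Bool), MeasurableSet E ∧ 0 < μ E ∧ dimH E ≤ ENNReal.ofReal u := by
  have hprob := hμ.1
  have h2 := Real.log_pos one_lt_two
  have hL := liminf_ent_nonneg hp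
  obtain ⟨s, hsL, hsu⟩ := exists_between huL
  obtain ⟨s', hs'L, hs's⟩ := exists_between hsL
  have hs0 : 0 < s := by linarith
  have hs'0 : 0 < s' := by linarith
  let A : ℕ → Set (ℕ → Bool) := fun n => {x | ((1 / 2 : ℝ) ^ n) ^ s ≤ wgt p (pre x n)}
  have hAm : ∀ n, MeasurableSet (A n) := fun n =>
    measurableSet_pre (fun ε => ((1 / 2 : ℝ) ^ n) ^ s ≤ wgt p ε)
  have hfr : ∃ᶠ n in atTop, μ (A n)ᶜ ≤ ENNReal.ofReal (s' / s) := by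
    refine ((frequently_lt_of_liminf_lt (ent_cobdd p) hs'L).and_eventually
      (eventually_ge_atTop 1)).mono ?_
    rintro n ⟨hn, hn1⟩
    have hn0 : (0 : ℝ) < n := by exact_mod_cast hn1
    have hle1 : ∀ ε : Fin n → Bool, wgt p ε ≤ 1 := fun ε => by
      rw [← sum_wgt hp n]
      exact Finset.single_le_sum (fun ε _ => (wgt_pos hp ε).le) (Finset.mem_univ ε)
    have hb := measure_pre_le hμ (n := n) (fun ε => ¬ ((1 / 2 : ℝ) ^ n) ^ s ≤ wgt p ε)
      (fun ε => -(wgt p ε * Real.log (wgt p ε)) * (1 / (n * s * Real.log 2)))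
      (fun ε => by
        have hw := wgt_pos hp ε
        have hl := Real.log_nonpos hw.le (hle1 ε)
        have : 0 ≤ -(wgt p ε * Real.log (wgt p ε)) := by nlinarith
        positivity)
      (fun ε hε => by
        have hw := wgt_pos hp ε
        rw [not_le, half_pow_rpow, ← Real.log_lt_iff_lt_exp hw] at hε
        rw [mul_one_div, le_div_iff₀ (by positivity)]
        nlinarith)
    have hset : (A n)ᶜ = {x | ¬ ((1 / 2 : ℝ) ^ n) ^ s ≤ wgt p (pre x n)} := rfl
    rw [hset]
    refine hb.trans (ENNReal.ofReal_le_ofReal ?_)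
    rw [← Finset.sum_mul]
    have h3 := deriv_tauN' hp hμ n
    rw [deriv_tauN hp hμ n] at h3
    have h4 : (∑ ε : Fin n → Bool, -(wgt p ε * Real.log (wgt p ε))) * (1 / (n * s * Real.log 2))
        = ent p n / s := by
      rw [h3]; field_simp
    rw [h4]
    exact div_le_div_of_nonneg_right hn.le hs0.le
  let E : Set (ℕ → Bool) := ⋂ m : ℕ, ⋃ (n : ℕ) (_ : m ≤ n), A n
  have hEm : MeasurableSet E := MeasurableSet.iInter fun m => MeasurableSet.iUnion fun n =>
    MeasurableSet.iUnion fun _ => hAm n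
  refine ⟨E, hEm, ?_, ?_⟩
  · have hcompl : Eᶜ = ⋃ m : ℕ, ⋂ (n : ℕ) (_ : m ≤ n), (A n)ᶜ := by
      simp only [E, Set.compl_iInter, Set.compl_iUnion]
    have hmono : Monotone fun m : ℕ => ⋂ (n : ℕ) (_ : m ≤ n), (A n)ᶜ := by
      intro a b hab x hx
      simp only [Set.mem_iInter] at hx ⊢
      exact fun n hn => hx n (hab.trans hn)
    have hlt : μ Eᶜ < 1 := by
      rw [hcompl, hmono.measure_iUnion]
      refine lt_of_le_of_lt (b := ENNReal.ofReal (s' / s)) (iSup_le fun m => ?_) ?_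
      · obtain ⟨n, hn, hmn⟩ := frequently_atTop.1 hfr m
        exact (measure_mono (Set.iInter₂_subset n hn)).trans hmn
      · rw [ENNReal.ofReal_lt_one, div_lt_one hs0]
        exact hs's
    by_contra hcon
    have hz : μ E = 0 := le_antisymm (not_lt.1 hcon) zero_le
    rw [(prob_compl_eq_one_iff hEm).2 hz] at hlt
    exact lt_irrefl _ hlt
  · refine dimH_cover (fun n ε => wgt p ε) (fun n ε => (wgt_pos hp ε).le) (fun n => sum_wgt hp n)
      hs0.le hsu ?_
    intro x hx
    rw [frequently_atTop]
    intro m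
    have := Set.mem_iInter.1 hx m
    simp only [Set.mem_iUnion, exists_prop] at this
    exact this

/-- Remark 2.2: entropy formula for the dimension. Let `μ` be an
inhomogeneous Bernoulli product with weights `(pₙ) ⊂ (0,1)`. Then the lower Hausdorff
dimension `dim_*(μ) = inf{dim E : E Borel, μ(E) > 0}` satisfies
`dim_*(μ) = liminf_n (-τ_{μ,n}'(1)) = -τ_μ'(1⁺)`, where
`-τ_{μ,n}'(1) = (1/(n log 2)) ∑_{I ∈ F_n} -μ(I) log μ(I)` is the `n`-th normalized
entropy of `μ` and `αp = τ_μ'(1⁺)` is the right derivative of `τ_μ` at `1`. -/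
theorem statement10
    (p : ℕ → ℝ) (hp : ∀ k, p k ∈ Set.Ioo (0 : ℝ) 1)
    (μ : Measure (ℕ → Bool)) (hμ : IsBernoulliProduct p μ)
    (αp : ℝ) (hαp : HasDerivWithinAt (tauLq μ) αp (Set.Ioi (1 : ℝ)) 1) :
    (⨅ (E : Set (ℕ → Bool)) (_ : MeasurableSet E) (_ : 0 < μ E), dimH E)
        = ENNReal.ofReal (liminf (fun n : ℕ => -deriv (tauN μ n) 1) atTop)
      ∧ liminf (fun n : ℕ => -deriv (tauN μ n) 1) atTop = -αp
      ∧ ∀ n : ℕ, 1 ≤ n →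
          -deriv (tauN μ n) 1
            = (1 / (n * Real.log 2))
                * ∑ ε : Fin n → Bool,
                    -((μ (cyl ε)).toReal * Real.log (μ (cyl ε)).toReal) := by

  have hent : (fun n : ℕ => -deriv (tauN μ n) 1) = ent p := funext (deriv_tauN hp hμ)
  refine ⟨?_, ?_, ?_⟩
  · rw [hent]
    apply le_antisymm
    · have hL := liminf_ent_nonneg hp
      refine ENNReal.le_of_forall_pos_le_add ?_
      intro e he _
      have he' : (0 : ℝ) < e := he
      obtain ⟨E, hE, hE0, hd⟩ := upper_bound hp hμ
        (u := liminf (ent p) atTop + e) (by linarith)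
      refine iInf_le_of_le E (iInf_le_of_le hE (iInf_le_of_le hE0 (hd.trans ?_)))
      rw [ENNReal.ofReal_add hL he'.le, ENNReal.ofReal_coe_nnreal]
    · refine le_iInf fun E => le_iInf fun hE => le_iInf fun hE0 => ?_
      refine le_of_forall_lt fun c hc => ?_
      obtain ⟨r, hcr, hrL⟩ := ENNReal.lt_iff_exists_nnreal_btwn.1 hc
      refine lt_of_lt_of_le hcr ?_
      have hr : (0 : ℝ) < r := by
        have : (0 : ENNReal) < r := lt_of_le_of_lt zero_le hcr
        exact_mod_cast this
      have hrL' : (r : ℝ) < liminf (ent p) atTop := by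
        rw [← ENNReal.ofReal_coe_nnreal] at hrL
        exact (ENNReal.ofReal_lt_ofReal_iff_of_nonneg hr.le).1 hrL
      rw [← ENNReal.ofReal_coe_nnreal]
      exact lower_bound hp hμ hr hrL' hE hE0
  · rw [hent]
    have := (uniqueDiffWithinAt_Ioi (1 : ℝ)).eq_deriv _ (hasDeriv_tauLq hp hμ) hαp
    linarith
  · intro n _
    rw [deriv_tauN' hp hμ n]
    simp_rw [mu_cyl_toReal hp hμ]
end
end

section
/- In the setting of the previous statement (λ_1,λ_2 ∈ (0,1) with λ_1+λ_2 = 1, 0 < p_1 < p_2 < 1/2, τ = λ_1 τ(p_1,·) + λ_2 τ(p_2,·), 1 < q_1 < q_2 < ∞, p_4 ∈ (p_1,p_2) with τ(p_4,q_1) = τ(q_1), p_5 ∈ (p_2,1/2), and (λ_3,λ_4,λ_5) the unique positive triple summing to 1 with τ̃ = λ_3 τ(p_1,·) + λ_4 τ(p_4,·) + λ_5 τ(p_5,·) agreeing with τ at q_1 and q_2), for every q > 1 one has τ̃(q) > τ(q) if and only if q ∈ (q_1,q_2). -/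
open MeasureTheory Filter Set

noncomputable section

/-- `τ(p,q) = log(p^q + (1-p)^q) / log 2`, the `L^q`-spectrum of the homogeneous
Bernoulli product with weight `p`. -/
def taup (p q : ℝ) : ℝ :=
  Real.log (p ^ q + (1 - p) ^ q) / Real.log 2

theorem t18_inc {f f' : ℝ → ℝ} {a b : ℝ} (hab : a < b)
    (h : ∀ x, a ≤ x → x ≤ b → HasDerivAt f (f' x) x)
    (hp : ∀ x, a < x → x < b → 0 < f' x) : f a < f b := by
  obtain ⟨c, hc, he⟩ := exists_hasDerivAt_eq_slope f f' hab
    (fun x hx => (h x hx.1 hx.2).continuousAt.continuousWithinAt)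
    (fun x hx => h x hx.1.le hx.2.le)
  have := hp c hc.1 hc.2
  rw [he] at this
  have h2 := (div_pos_iff_of_pos_right (sub_pos.2 hab)).1 this
  linarith

theorem t18_dec {f f' : ℝ → ℝ} {a b : ℝ} (hab : a < b)
    (h : ∀ x, a ≤ x → x ≤ b → HasDerivAt f (f' x) x)
    (hp : ∀ x, a < x → x < b → f' x < 0) : f b < f a := by
  have := t18_inc (f := fun x => - f x) (f' := fun x => - f' x) hab
    (fun x h1 h2 => (h x h1 h2).neg) (fun x h1 h2 => by have := hp x h1 h2; linarith)
  linarith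

theorem t18_tanh (x : ℝ) : HasDerivAt Real.tanh (1 - Real.tanh x ^ 2) x := by
  have h : Real.tanh = fun x => Real.sinh x / Real.cosh x := by
    funext y; exact Real.tanh_eq_sinh_div_cosh y
  have h1 := (Real.hasDerivAt_sinh x).div (Real.hasDerivAt_cosh x) (Real.cosh_pos x).ne'
  rw [h]
  convert! h1 using 1
  have := (Real.cosh_pos x).ne'
  field_simp

theorem t18_logcosh (x : ℝ) : HasDerivAt (fun x => Real.log (Real.cosh x)) (Real.tanh x) x := by
  have h1 := (Real.hasDerivAt_cosh x).log (Real.cosh_pos x).ne'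
  rwa [Real.tanh_eq_sinh_div_cosh]

theorem t18_T_pos {x : ℝ} (hx : 0 < x) : 0 < Real.tanh x := by
  rw [Real.tanh_eq_sinh_div_cosh]
  exact div_pos (Real.sinh_pos_iff.2 hx) (Real.cosh_pos x)

theorem t18_S_eq (x : ℝ) : 1 - Real.tanh x ^ 2 = 1 / Real.cosh x ^ 2 := by
  rw [Real.tanh_eq_sinh_div_cosh]
  have := (Real.cosh_pos x).ne'
  field_simp
  linarith [Real.cosh_sq x]

theorem t18_S_pos (x : ℝ) : 0 < 1 - Real.tanh x ^ 2 := by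
  rw [t18_S_eq]
  have := (Real.cosh_pos x)
  positivity

theorem t18_T_lt {x : ℝ} (hx : 0 < x) : Real.tanh x < x := by
  have := t18_inc (f := fun x => x - Real.tanh x) (f' := fun x => 1 - (1 - Real.tanh x ^ 2)) hx
    (fun y _ _ => (hasDerivAt_id y).sub (t18_tanh y))
    (fun y h _ => by have := t18_T_pos h; ring_nf; positivity)
  simp at this
  linarith

theorem t18_xS {x : ℝ} (hx : 0 < x) : x ^ 2 * (1 - Real.tanh x ^ 2) ≤ Real.tanh x ^ 2 := by
  rw [t18_S_eq, Real.tanh_eq_sinh_div_cosh, div_pow, mul_one_div]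
  have := Real.cosh_pos x
  have h2 := Real.self_le_sinh_iff.2 hx.le
  gcongr

/-- X -/
def t18X (x : ℝ) : ℝ := x * Real.tanh x
/-- X' -/
def t18X1 (x : ℝ) : ℝ := Real.tanh x + x * (1 - Real.tanh x ^ 2)
/-- Y -/
def t18Y (x : ℝ) : ℝ := 3 * (x * Real.tanh x) ^ 2 - x ^ 2
/-- rho -/
def t18r (x : ℝ) : ℝ := 6 * t18X x - 2 * x / t18X1 x

theorem t18_X1_pos {x : ℝ} (hx : 0 < x) : 0 < t18X1 x := by
  have := t18_T_pos hx
  have := t18_S_pos x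
  unfold t18X1
  positivity

theorem t18_dX (x : ℝ) : HasDerivAt t18X (t18X1 x) x := by
  have := (hasDerivAt_id x).mul (t18_tanh x)
  convert! this using 1
  simp [t18X1]

theorem t18_dX1 (x : ℝ) : HasDerivAt t18X1
    (2 * (1 - Real.tanh x ^ 2) - 2 * x * Real.tanh x * (1 - Real.tanh x ^ 2)) x := by
  have := (t18_tanh x).add ((hasDerivAt_id x).mul (((t18_tanh x).pow 2).const_sub 1))
  convert! this using 1
  simp
  ring

theorem t18_dY {x : ℝ} (hx : 0 < x) : HasDerivAt t18Y (t18r x * t18X1 x) x := by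
  have := (((t18_dX x).pow 2).const_mul 3).sub ((hasDerivAt_id x).pow 2)
  convert! this using 1
  have := (t18_X1_pos hx).ne'
  simp [t18r]
  field_simp
  ring

theorem t18_key {x : ℝ} (hx : 0 < x) :
    t18X1 x - x * (2 * (1 - Real.tanh x ^ 2) - 2 * x * Real.tanh x * (1 - Real.tanh x ^ 2))
      < 3 * t18X1 x ^ 3 := by
  have h1 := t18_T_pos hx
  have h2 := t18_S_pos x
  have h3 := t18_T_lt hx
  have h4 := t18_xS hx
  unfold t18X1
  generalize hT : Real.tanh x = T at *
  obtain ⟨S, hS⟩ : ∃ S, S = 1 - T ^ 2 := ⟨_, rfl⟩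
  rw [← hS] at h2 h4
  simp only [← hS]
  have e1 : T * S ≤ x * S := by gcongr
  have e2 : T ^ 3 * (x ^ 2 * S) ≤ T ^ 3 * T ^ 2 := by gcongr
  have e3 : T ^ 3 * T ^ 2 ≤ T ^ 3 * 1 := by
    have : T ^ 2 ≤ 1 := by linarith
    gcongr
  have e4 : x ^ 2 * T * S = x ^ 2 * T * S * (S + T ^ 2) := by rw [hS]; ring
  have e5 : T = T * S + T ^ 3 := by rw [hS]; ring
  have p1 : 0 < T ^ 2 * x * S := by positivity
  have p2 : 0 < T * x ^ 2 * S ^ 2 := by positivity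
  have p3 : 0 < x ^ 3 * S ^ 3 := by positivity
  nlinarith

theorem t18_dr {x : ℝ} (hx : 0 < x) : ∃ d, 0 < d ∧ HasDerivAt t18r d x := by
  have hp := t18_X1_pos hx
  have := ((t18_dX x).const_mul 6).sub ((((hasDerivAt_id x).const_mul 2)).div (t18_dX1 x) hp.ne')
  refine ⟨_, ?_, this⟩
  have hk := t18_key hx
  simp only [id]
  rw [sub_pos, div_lt_iff₀ (by positivity)]
  nlinarith

theorem t18_r_mono {x y : ℝ} (hx : 0 < x) (hxy : x < y) : t18r x < t18r y := by
  choose! d hd using fun x (hx : 0 < x) => t18_dr hx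
  exact t18_inc hxy (fun z h _ => (hd z (by linarith)).2) (fun z h _ => (hd z (by linarith)).1)

theorem t18_X_mono {x y : ℝ} (hx : 0 < x) (hxy : x < y) : t18X x < t18X y :=
  t18_inc hxy (fun z _ _ => t18_dX z) (fun z h _ => t18_X1_pos (by linarith))

theorem t18_slope {x y : ℝ} (hx : 0 < x) (hxy : x < y) :
    ∃ c, x < c ∧ c < y ∧ t18Y y - t18Y x = t18r c * (t18X y - t18X x) := by
  obtain ⟨c, hc, h⟩ := exists_ratio_hasDerivAt_eq_ratio_slope t18Y (fun x => t18r x * t18X1 x) hxy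
    (fun z hz => (t18_dY (by linarith [hz.1])).continuousAt.continuousWithinAt)
    (fun z hz => (t18_dY (by linarith [hz.1])))
    t18X t18X1
    (fun z hz => (t18_dX z).continuousAt.continuousWithinAt)
    (fun z hz => (t18_dX z))
  refine ⟨c, hc.1, hc.2, ?_⟩
  have := t18_X1_pos (x := c) (by linarith [hc.1])
  apply mul_right_cancel₀ this.ne'
  linarith

theorem t18_three {x y z : ℝ} (hx : 0 < x) (hxy : x < y) (hyz : y < z) :
    (t18Y y - t18Y x) * (t18X z - t18X y) < (t18Y z - t18Y y) * (t18X y - t18X x) := by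
  obtain ⟨c, h1, h2, h3⟩ := t18_slope hx hxy
  obtain ⟨d, h4, h5, h6⟩ := t18_slope (hx.trans hxy) hyz
  rw [h3, h6]
  have a1 := t18_r_mono (x := c) (y := d) (by linarith) (by linarith)
  have a2 := t18_X_mono hx hxy
  have a3 := t18_X_mono (hx.trans hxy) hyz
  have := mul_pos (sub_pos.2 a2) (sub_pos.2 a3)
  nlinarith

/-- F0 -/
def t18F0 (x : ℝ) : ℝ := x * Real.tanh x - Real.log (Real.cosh x)
/-- F1 -/
def t18F1 (x : ℝ) : ℝ := x ^ 2 * (1 - Real.tanh x ^ 2) - 2 * t18F0 x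
/-- F2 -/
def t18F2 (x : ℝ) : ℝ := -3 * (x ^ 2 * (1 - Real.tanh x ^ 2))
  - 2 * (x ^ 3 * Real.tanh x * (1 - Real.tanh x ^ 2)) + 6 * t18F0 x

theorem t18_dF0 (x : ℝ) : HasDerivAt t18F0 (x * (1 - Real.tanh x ^ 2)) x := by
  have := (t18_dX x).sub (t18_logcosh x)
  convert! this using 1
  simp [t18X1]

theorem t18_dF1 (x : ℝ) : HasDerivAt t18F1
    (-2 * x * (1 - Real.tanh x ^ 2) * t18X x) x := by
  have := (((hasDerivAt_id x).pow 2).mul (((t18_tanh x).pow 2).const_sub 1)).sub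
    ((t18_dF0 x).const_mul 2)
  convert! this using 1
  simp [t18X]
  ring

theorem t18_dF2 (x : ℝ) : HasDerivAt t18F2
    (2 * x * (1 - Real.tanh x ^ 2) * t18Y x) x := by
  have hS := ((t18_tanh x).pow 2).const_sub 1
  have := (((((hasDerivAt_id x).pow 2).mul hS).const_mul (-3)).sub
    (((((hasDerivAt_id x).pow 3).mul (t18_tanh x)).mul hS).const_mul 2)).add
    ((t18_dF0 x).const_mul 6)
  convert! this using 1
  simp [t18Y]
  ring

/-- g0 -/
def t18g0 (s q : ℝ) : ℝ := t18F0 (q * s) / q ^ 2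
/-- g1 -/
def t18g1 (s q : ℝ) : ℝ := t18F1 (q * s) / q ^ 3
/-- g2 -/
def t18g2 (s q : ℝ) : ℝ := t18F2 (q * s) / q ^ 4

theorem t18_dmul (s q : ℝ) : HasDerivAt (fun q : ℝ => q * s) s q := by
  simpa using (hasDerivAt_id q).mul_const s

theorem t18_dg0 (s : ℝ) {q : ℝ} (hq : 0 < q) : HasDerivAt (t18g0 s) (t18g1 s q) q := by
  have := ((t18_dF0 (q * s)).comp q (t18_dmul s q)).div ((hasDerivAt_id q).pow 2)
    (by simp; positivity)
  convert! this using 1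
  simp [t18g1, t18F1]
  field_simp

theorem t18_dg1 (s : ℝ) {q : ℝ} (hq : 0 < q) : HasDerivAt (t18g1 s) (t18g2 s q) q := by
  have := ((t18_dF1 (q * s)).comp q (t18_dmul s q)).div ((hasDerivAt_id q).pow 3)
    (by simp; positivity)
  convert! this using 1
  simp [t18g2, t18F2, t18F1, t18X]
  field_simp
  ring

/-- comb -/
def t18c (C₁ C₂ C₃ h b a l : ℝ) (g : ℝ → ℝ) : ℝ :=
  C₁ * (g h - g b) + C₂ * (g b - g a) + C₃ * (g a - g l)

theorem t18_dc (C₁ C₂ C₃ h b a l : ℝ) {g g' : ℝ → ℝ → ℝ} {q : ℝ}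
    (hg : ∀ s, HasDerivAt (g s) (g' s q) q) :
    HasDerivAt (fun q => t18c C₁ C₂ C₃ h b a l (fun s => g s q))
      (t18c C₁ C₂ C₃ h b a l (fun s => g' s q)) q :=
  ((((hg h).sub (hg b)).const_mul C₁).add (((hg b).sub (hg a)).const_mul C₂)).add
    (((hg a).sub (hg l)).const_mul C₃)

theorem t18_c_neg1 {C₁ C₂ C₃ h b a l : ℝ} {g : ℝ → ℝ} (h1 : C₁ ≤ 0) (h2 : C₂ ≤ 0) (h3 : C₃ < 0)
    (g1 : g b < g h) (g2 : g a < g b) (g3 : g l < g a) : t18c C₁ C₂ C₃ h b a l g < 0 := by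
  unfold t18c
  have e1 := mul_nonneg (neg_nonneg.2 h1) (sub_pos.2 g1).le
  have e2 := mul_nonneg (neg_nonneg.2 h2) (sub_pos.2 g2).le
  have e3 := mul_pos (neg_pos.2 h3) (sub_pos.2 g3)
  linarith

theorem t18_c_neg2 {C₁ C₂ C₃ h b a l : ℝ} {g : ℝ → ℝ} (h1 : 0 ≤ C₁) (h2 : 0 ≤ C₂) (h3 : C₃ < 0)
    (g1 : g h < g b) (g2 : g b < g a) (g3 : g l < g a) : t18c C₁ C₂ C₃ h b a l g < 0 := by
  unfold t18c
  have e1 := mul_nonneg h1 (sub_pos.2 g1).le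
  have e2 := mul_nonneg h2 (sub_pos.2 g2).le
  have e3 := mul_pos (neg_pos.2 h3) (sub_pos.2 g3)
  linarith

theorem t18_c_neg3 {C₁ C₂ C₃ h b a l : ℝ} {g : ℝ → ℝ} (h1 : C₁ ≤ 0) (h2 : 0 ≤ C₂) (h3 : C₃ < 0)
    (g1 : g b < g h) (g2 : g b < g a) (g3 : g l < g a) : t18c C₁ C₂ C₃ h b a l g < 0 := by
  unfold t18c
  have e1 := mul_nonneg (neg_nonneg.2 h1) (sub_pos.2 g1).le
  have e2 := mul_nonneg h2 (sub_pos.2 g2).le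
  have e3 := mul_pos (neg_pos.2 h3) (sub_pos.2 g3)
  linarith

theorem t18_F0_mono {x y : ℝ} (hx : 0 < x) (hxy : x < y) : t18F0 x < t18F0 y :=
  t18_inc hxy (fun z _ _ => t18_dF0 z) (fun z h _ => mul_pos (by linarith) (t18_S_pos z))

theorem t18_dcosh2 (a q : ℝ) : HasDerivAt (fun q => Real.cosh (q * a) ^ 2)
    (Real.cosh (q * a) ^ 2 * (2 * a * Real.tanh (q * a))) q := by
  have := ((Real.hasDerivAt_cosh (q * a)).comp q (t18_dmul a q)).pow 2
  convert! this using 1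
  have := (Real.cosh_pos (q * a)).ne'
  rw [Real.tanh_eq_sinh_div_cosh]
  simp
  field_simp

/-- n -/
def t18n (A x : ℝ) : ℝ := t18F1 x + 2 * t18X A * t18F0 x

theorem t18_dn (A x : ℝ) : HasDerivAt (t18n A)
    (2 * (x * (1 - Real.tanh x ^ 2)) * (t18X A - t18X x)) x := by
  have := (t18_dF1 x).add ((t18_dF0 x).const_mul (2 * t18X A))
  convert! this using 1
  ring

theorem t18_n_inc {A x y : ℝ} (hx : 0 < x) (hxy : x < y) (hy : y ≤ A) : t18n A x < t18n A y :=
  t18_inc hxy (fun z _ _ => t18_dn A z) (fun z h h' => by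
    have hz : 0 < z := by linarith
    have := t18_S_pos z
    have := sub_pos.2 (t18_X_mono hz (show z < A by linarith))
    positivity)

theorem t18_n_dec {A x y : ℝ} (hx : 0 < x) (hxy : x < y) (hA : 0 < A) (hy : A ≤ x) :
    t18n A y < t18n A x :=
  t18_dec hxy (fun z _ _ => t18_dn A z) (fun z h h' => by
    have hz : 0 < z := by linarith
    have := t18_S_pos z
    have := sub_neg.2 (t18_X_mono hA (show A < z by linarith))
    exact mul_neg_of_pos_of_neg (by positivity) this)

/-- N -/
def t18N (A B x : ℝ) : ℝ := t18F2 x * (t18X B - t18X A) + t18F1 x * (t18Y B - t18Y A)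
  + t18F0 x * (-2 * t18Y A * (t18X B - t18X A) + 2 * t18X A * (t18Y B - t18Y A))

theorem t18_dN (A B x : ℝ) : HasDerivAt (t18N A B)
    (2 * (x * (1 - Real.tanh x ^ 2)) * ((t18X B - t18X A) * (t18Y x - t18Y A)
      - (t18Y B - t18Y A) * (t18X x - t18X A))) x := by
  have := (((t18_dF2 x).mul_const (t18X B - t18X A)).add
    ((t18_dF1 x).mul_const (t18Y B - t18Y A))).add
    ((t18_dF0 x).mul_const (-2 * t18Y A * (t18X B - t18X A) + 2 * t18X A * (t18Y B - t18Y A)))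
  convert! this using 1
  ring

theorem t18_N_inc1 {A B x y : ℝ} (hx : 0 < x) (hxy : x < y) (hy : y ≤ A) (hAB : A < B) :
    t18N A B x < t18N A B y :=
  t18_inc hxy (fun z _ _ => t18_dN A B z) (fun z h h' => by
    have hz : 0 < z := by linarith
    have := t18_S_pos z
    have := t18_three hz (show z < A by linarith) hAB
    exact mul_pos (by positivity) (by linarith))

theorem t18_N_dec {A B x y : ℝ} (hA : 0 < A) (hxy : x < y) (hx : A ≤ x) (hy : y ≤ B) :
    t18N A B y < t18N A B x :=
  t18_dec hxy (fun z _ _ => t18_dN A B z) (fun z h h' => by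
    have hz : 0 < z := by linarith
    have := t18_S_pos z
    have := t18_three hA (show A < z by linarith) (show z < B by linarith)
    exact mul_neg_of_pos_of_neg (by positivity) (by linarith))

theorem t18_N_inc2 {A B x y : ℝ} (hA : 0 < A) (hxy : x < y) (hAB : A < B) (hx : B ≤ x) :
    t18N A B x < t18N A B y :=
  t18_inc hxy (fun z _ _ => t18_dN A B z) (fun z h h' => by
    have hz : 0 < z := by linarith
    have := t18_S_pos z
    have := t18_three hA hAB (show B < z by linarith)
    exact mul_pos (by positivity) (by linarith))

/-- P -/
def t18P (C₁ C₂ C₃ h b a l q : ℝ) : ℝ := t18c C₁ C₂ C₃ h b a l (fun s => t18g1 s q)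
    + 2 * a * Real.tanh (q * a) * t18c C₁ C₂ C₃ h b a l (fun s => t18g0 s q)

theorem t18_df (C₁ C₂ C₃ h b a l : ℝ) {q : ℝ} (hq : 0 < q) :
    HasDerivAt (fun q => t18c C₁ C₂ C₃ h b a l (fun s => t18g0 s q) * Real.cosh (q * a) ^ 2)
      (Real.cosh (q * a) ^ 2 * t18P C₁ C₂ C₃ h b a l q) q := by
  have := (t18_dc C₁ C₂ C₃ h b a l (g := t18g0) (g' := t18g1) (fun s => t18_dg0 s hq)).mul
    (t18_dcosh2 a q)
  convert! this using 1
  simp only [t18P]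
  ring

theorem t18_P_eq (C₁ C₂ C₃ h b a l : ℝ) {q : ℝ} (hq : 0 < q) :
    t18P C₁ C₂ C₃ h b a l q
      = t18c C₁ C₂ C₃ h b a l (fun s => t18n (q * a) (q * s)) / q ^ 3 := by
  simp only [t18P, t18c, t18n, t18g0, t18g1, t18X]
  field_simp
  ring

/-- H -/
def t18H (C₁ C₂ C₃ h b a l q : ℝ) : ℝ := t18P C₁ C₂ C₃ h b a l q * Real.cosh (q * b) ^ 2
  / (b * Real.tanh (q * b) - a * Real.tanh (q * a))

theorem t18_dT (a q : ℝ) : HasDerivAt (fun q => a * Real.tanh (q * a))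
    (a ^ 2 * (1 - Real.tanh (q * a) ^ 2)) q := by
  have := ((t18_tanh (q * a)).comp q (t18_dmul a q)).const_mul a
  convert! this using 1
  ring

theorem t18_Delta {a b q : ℝ} (ha : 0 < a) (hab : a < b) (hq : 0 < q) :
    0 < b * Real.tanh (q * b) - a * Real.tanh (q * a) := by
  have := t18_X_mono (x := q * a) (y := q * b) (by positivity) (by gcongr)
  unfold t18X at this
  by_contra hc
  have := mul_nonneg hq.le (neg_nonneg.2 (not_lt.1 hc))
  linarith

theorem t18_dH (C₁ C₂ C₃ h : ℝ) {b a l q : ℝ} (ha : 0 < a) (hab : a < b) (hq : 0 < q) :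
    HasDerivAt (t18H C₁ C₂ C₃ h b a l)
      (Real.cosh (q * b) ^ 2 / (b * Real.tanh (q * b) - a * Real.tanh (q * a)) ^ 2 / q ^ 5
        * t18c C₁ C₂ C₃ h b a l (fun s => t18N (q * a) (q * b) (q * s))) q := by
  have hd := t18_Delta ha hab hq
  have d0 := t18_dc C₁ C₂ C₃ h b a l (g := t18g0) (g' := t18g1) (fun s => t18_dg0 s hq)
  have d1 := t18_dc C₁ C₂ C₃ h b a l (g := t18g1) (g' := t18g2) (fun s => t18_dg1 s hq)
  have dP := d1.add (((t18_dT a q).const_mul 2).mul d0)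
  have := (dP.mul (t18_dcosh2 b q)).div ((t18_dT b q).sub (t18_dT a q)) hd.ne'
  convert! this using 1
  · funext q
    simp [t18H, t18P]
    ring
  · simp only [Pi.add_apply, Pi.mul_apply, Pi.sub_apply]
    have key : t18c C₁ C₂ C₃ h b a l (fun s => t18N (q * a) (q * b) (q * s))
      = q ^ 4 * t18c C₁ C₂ C₃ h b a l (fun s => t18g2 s q) * (t18X (q * b) - t18X (q * a))
      + q ^ 3 * t18c C₁ C₂ C₃ h b a l (fun s => t18g1 s q) * (t18Y (q * b) - t18Y (q * a))
      + q ^ 2 * t18c C₁ C₂ C₃ h b a l (fun s => t18g0 s q)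
        * (-2 * t18Y (q * a) * (t18X (q * b) - t18X (q * a))
          + 2 * t18X (q * a) * (t18Y (q * b) - t18Y (q * a))) := by
      simp only [t18c, t18N, t18g0, t18g1, t18g2]
      field_simp
      ring
    rw [key]
    generalize t18c C₁ C₂ C₃ h b a l (fun s => t18g2 s q) = G2
    generalize t18c C₁ C₂ C₃ h b a l (fun s => t18g1 s q) = G1
    generalize t18c C₁ C₂ C₃ h b a l (fun s => t18g0 s q) = G0
    simp only [t18X, t18Y]
    generalize Real.tanh (q * a) = Ta at *
    generalize Real.tanh (q * b) = Tb at *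
    generalize Real.cosh (q * b) = Cb at *
    rw [div_div, div_mul_eq_mul_div, div_eq_div_iff (by positivity) (by positivity)]
    ring

theorem t18_main {C₁ C₂ C₃ h b a l x y : ℝ} (hl : 0 < l) (hla : l < a) (hab : a < b) (hbh : b < h)
    (hC : C₁ < C₂) (hC3 : C₃ < 0) (hx : 0 < x) (hxy : x < y)
    (h1 : t18c C₁ C₂ C₃ h b a l (fun s => t18g0 s x) = 0)
    (h2 : t18c C₁ C₂ C₃ h b a l (fun s => t18g0 s y) = 0) :
    (∀ q, 0 < q → q < x → t18c C₁ C₂ C₃ h b a l (fun s => t18g0 s q) < 0) ∧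
    (∀ q, x < q → q < y → 0 < t18c C₁ C₂ C₃ h b a l (fun s => t18g0 s q)) ∧
    (∀ q, y < q → t18c C₁ C₂ C₃ h b a l (fun s => t18g0 s q) < 0) := by
  have ha : 0 < a := hl.trans hla
  have hb : 0 < b := ha.trans hab
  have hC2 : 0 < C₂ := by
    by_contra hc
    have hc := not_lt.1 hc
    have hg : ∀ u v : ℝ, 0 < u → u < v → t18g0 u x < t18g0 v x := by
      intro u v hu huv
      have := t18_F0_mono (x := x * u) (y := x * v) (by positivity) (by gcongr)
      unfold t18g0
      gcongr
    have := t18_c_neg1 (C₁ := C₁) (h := h) (b := b) (a := a) (l := l) (g := fun s => t18g0 s x)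
      (hC.le.trans hc) hc hC3 (hg _ _ hb hbh) (hg _ _ ha hab)
      (hg _ _ hl hla)
    linarith
  have hC1 : C₁ ≤ 0 := by
    by_contra hc
    have hc := not_le.1 hc
    have := t18_dec hxy (fun z h' _ => t18_df C₁ C₂ C₃ h b a l (q := z) (by linarith))
      (fun z h' _ => by
        have hz : 0 < z := by linarith
        have hcz := Real.cosh_pos (z * a)
        refine mul_neg_of_pos_of_neg (by positivity) ?_
        rw [t18_P_eq _ _ _ _ _ _ _ hz]
        refine div_neg_of_neg_of_pos (t18_c_neg2 hc.le hC2.le hC3 ?_ ?_ ?_) (by positivity)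
        · exact t18_n_dec (by positivity) (by gcongr) (by positivity) (by gcongr)
        · exact t18_n_dec (by positivity) (by gcongr) (by positivity) le_rfl
        · exact t18_n_inc (by positivity) (by gcongr) le_rfl)
    simp only [h1, h2] at this
    linarith
  have hH : ∀ u v, 0 < u → u < v → t18H C₁ C₂ C₃ h b a l v < t18H C₁ C₂ C₃ h b a l u := by
    intro u v hu huv
    refine t18_dec huv (fun z h' _ => t18_dH C₁ C₂ C₃ h ha hab (by linarith)) (fun z h' _ => ?_)
    have hz : 0 < z := by linarith
    have hcz := Real.cosh_pos (z * b)
    have hd := t18_Delta ha hab hz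
    refine mul_neg_of_pos_of_neg (by positivity) (t18_c_neg3 hC1 hC2.le hC3 ?_ ?_ ?_)
    · exact t18_N_inc2 (by positivity) (by gcongr) (by gcongr) le_rfl
    · exact t18_N_dec (by positivity) (by gcongr) le_rfl le_rfl
    · exact t18_N_inc1 (by positivity) (by gcongr) le_rfl (by gcongr)
  set f := fun q => t18c C₁ C₂ C₃ h b a l (fun s => t18g0 s q) * Real.cosh (q * a) ^ 2 with hf
  have hdf : ∀ q, 0 < q → HasDerivAt f (Real.cosh (q * a) ^ 2 * t18P C₁ C₂ C₃ h b a l q) q :=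
    fun q hq => t18_df C₁ C₂ C₃ h b a l hq
  have fx : f x = 0 := by simp [hf, h1]
  have fy : f y = 0 := by simp [hf, h2]
  have hPH : ∀ q, 0 < q → t18P C₁ C₂ C₃ h b a l q = t18H C₁ C₂ C₃ h b a l q *
      ((b * Real.tanh (q * b) - a * Real.tanh (q * a)) / Real.cosh (q * b) ^ 2) := by
    intro q hq
    have hcz := (Real.cosh_pos (q * b)).ne'
    have hd := (t18_Delta ha hab hq).ne'
    unfold t18H
    field_simp
  have hw : ∀ q, 0 < q → 0 < (b * Real.tanh (q * b) - a * Real.tanh (q * a))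
      / Real.cosh (q * b) ^ 2 := by
    intro q hq
    have hcz := (Real.cosh_pos (q * b))
    have hd := (t18_Delta ha hab hq)
    positivity
  obtain ⟨e, he, hez⟩ := exists_hasDerivAt_eq_zero hxy
    (fun z hz => (hdf z (by linarith [hz.1])).continuousAt.continuousWithinAt) (fx.trans fy.symm)
    (fun z hz => hdf z (by linarith [hz.1]))
  have he0 : 0 < e := hx.trans he.1
  have hHe : t18H C₁ C₂ C₃ h b a l e = 0 := by
    have hc := (Real.cosh_pos (e * a)).ne'
    have := (hw e he0).ne'
    rw [hPH e he0] at hez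
    simpa [hc, this] using hez
  have finc : ∀ u v, 0 < u → u < v → v ≤ e → f u < f v := by
    intro u v hu huv hv
    refine t18_inc huv (fun z h' _ => hdf z (by linarith)) (fun z h' h'' => ?_)
    have hz : 0 < z := by linarith
    rw [hPH z hz]
    have := hH z e hz (by linarith)
    rw [hHe] at this
    have := hw z hz
    have := Real.cosh_pos (z * a)
    positivity
  have fdec : ∀ u v, e ≤ u → u < v → f v < f u := by
    intro u v hu huv
    refine t18_dec huv (fun z h' _ => hdf z (by linarith)) (fun z h' h'' => ?_)
    have hz : 0 < z := by linarith
    rw [hPH z hz]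
    have h3 := hH e z he0 (by linarith)
    rw [hHe] at h3
    have := hw z hz
    have := Real.cosh_pos (z * a)
    exact mul_neg_of_pos_of_neg (by positivity) (mul_neg_of_neg_of_pos h3 (by positivity))
  have neg_of : ∀ q, f q < 0 → t18c C₁ C₂ C₃ h b a l (fun s => t18g0 s q) < 0 := by
    intro q hq
    have := Real.cosh_pos (q * a)
    by_contra hc
    have := mul_nonneg (not_lt.1 hc) (by positivity : 0 ≤ Real.cosh (q * a) ^ 2)
    simp only [hf] at hq
    linarith
  have pos_of : ∀ q, 0 < f q → 0 < t18c C₁ C₂ C₃ h b a l (fun s => t18g0 s q) := by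
    intro q hq
    have := Real.cosh_pos (q * a)
    exact pos_of_mul_pos_left hq (by positivity)
  refine ⟨fun q hq hqx => neg_of q ?_, fun q hq hqx => pos_of q ?_, fun q hq => neg_of q ?_⟩
  · have := finc q x hq hqx he.1.le
    linarith
  · rcases le_total q e with h' | h'
    · have := finc x q hx hq h'
      linarith
    · have := fdec q y h' hqx
      linarith
  · have := fdec y q he.2.le hq
    linarith

/-- s -/
def t18s (p : ℝ) : ℝ := (Real.log (1 - p) - Real.log p) / 2
/-- m -/
def t18m (p : ℝ) : ℝ := (Real.log (1 - p) + Real.log p) / 2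

theorem t18_taup {p : ℝ} (h0 : 0 < p) (h1 : p < 1 / 2) (q : ℝ) :
    taup p q = (Real.log (Real.cosh (q * t18s p)) + q * t18m p + Real.log 2) / Real.log 2 := by
  have h2 : 0 < 1 - p := by linarith
  unfold taup
  congr 1
  rw [Real.rpow_def_of_pos h0, Real.rpow_def_of_pos h2]
  have : Real.exp (Real.log p * q) + Real.exp (Real.log (1 - p) * q)
      = Real.exp (q * t18m p) * (2 * Real.cosh (q * t18s p)) := by
    rw [Real.cosh_eq]
    have e1 : Real.log p * q = q * t18m p + -(q * t18s p) := by unfold t18s t18m; ring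
    have e2 : Real.log (1 - p) * q = q * t18m p + q * t18s p := by unfold t18s t18m; ring
    rw [e1, e2, Real.exp_add, Real.exp_add]
    ring
  have hc := Real.cosh_pos (q * t18s p)
  rw [this, Real.log_mul (Real.exp_pos _).ne' (by positivity), Real.log_exp,
    Real.log_mul (by norm_num) hc.ne']
  ring

theorem t18_taup_one (p : ℝ) : taup p 1 = 0 := by
  simp [taup]

theorem t18_s_anti {p r : ℝ} (h0 : 0 < p) (hpr : p < r) (h1 : r < 1 / 2) : t18s r < t18s p := by
  unfold t18s
  have := Real.log_lt_log h0 hpr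
  have := Real.log_lt_log (show 0 < 1 - r by linarith) (show 1 - r < 1 - p by linarith)
  linarith

theorem t18_s_pos {p : ℝ} (h0 : 0 < p) (h1 : p < 1 / 2) : 0 < t18s p := by
  unfold t18s
  have := Real.log_lt_log h0 (show p < 1 - p by linarith)
  linarith

/-- g -/
def t18g (s q : ℝ) : ℝ := Real.log (Real.cosh (q * s)) / q

theorem t18_dg (s : ℝ) {q : ℝ} (hq : 0 < q) : HasDerivAt (t18g s) (t18g0 s q) q := by
  have := ((t18_logcosh (q * s)).comp q (t18_dmul s q)).div (hasDerivAt_id q) hq.ne'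
  convert! this using 1
  simp [t18g0, t18F0]
  field_simp


/-- Lemma 5.4. In the setting of Lemma 5.3 — `λ₁,λ₂ ∈ (0,1)` with
`λ₁ + λ₂ = 1`, `0 < p₁ < p₂ < 1/2`, `τ = λ₁ τ(p₁,·) + λ₂ τ(p₂,·)`, `1 < q₁ < q₂`,
`p₄ ∈ (p₁,p₂)` with `τ(p₄,q₁) = τ(q₁)`, `p₅ ∈ (p₂,1/2)`, and `(λ₃,λ₄,λ₅)` the positive
triple summing to `1` for which `τ̃ = λ₃ τ(p₁,·) + λ₄ τ(p₄,·) + λ₅ τ(p₅,·)` agrees with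
`τ` at `q₁` and `q₂` — one has, for every `q > 1`: `τ̃(q) > τ(q)` iff `q ∈ (q₁,q₂)`. -/
theorem statement18
    (lam₁ lam₂ p₁ p₂ p₄ p₅ q₁ q₂ lam₃ lam₄ lam₅ : ℝ)
    (hl₁ : lam₁ ∈ Set.Ioo (0 : ℝ) 1) (hl₂ : lam₂ ∈ Set.Ioo (0 : ℝ) 1)
    (hlsum : lam₁ + lam₂ = 1)
    (hp₁ : 0 < p₁) (hp₁₂ : p₁ < p₂) (hp₂ : p₂ < 1 / 2)
    (hq₁ : 1 < q₁) (hq₁₂ : q₁ < q₂)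
    (hp₄ : p₄ ∈ Set.Ioo p₁ p₂)
    (hp₄q₁ : taup p₄ q₁ = lam₁ * taup p₁ q₁ + lam₂ * taup p₂ q₁)
    (hp₅ : p₅ ∈ Set.Ioo p₂ (1 / 2 : ℝ))
    (hl₃ : 0 < lam₃) (hl₄ : 0 < lam₄) (hl₅ : 0 < lam₅)
    (hsum : lam₃ + lam₄ + lam₅ = 1)
    (hagree₁ : lam₃ * taup p₁ q₁ + lam₄ * taup p₄ q₁ + lam₅ * taup p₅ q₁
        = lam₁ * taup p₁ q₁ + lam₂ * taup p₂ q₁)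
    (hagree₂ : lam₃ * taup p₁ q₂ + lam₄ * taup p₄ q₂ + lam₅ * taup p₅ q₂
        = lam₁ * taup p₁ q₂ + lam₂ * taup p₂ q₂) :
    ∀ q : ℝ, 1 < q →
      (lam₁ * taup p₁ q + lam₂ * taup p₂ q
          < lam₃ * taup p₁ q + lam₄ * taup p₄ q + lam₅ * taup p₅ q
        ↔ q ∈ Set.Ioo q₁ q₂) := by
  intro q hq
  obtain ⟨h4a, h4b⟩ := hp₄
  obtain ⟨h5a, h5b⟩ := hp₅
  have s41 := t18_s_anti hp₁ h4a (by linarith)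
  have s24 := t18_s_anti (by linarith) h4b hp₂
  have s52 := t18_s_anti (by linarith) h5a h5b
  have s5 := t18_s_pos (show 0 < p₅ by linarith) h5b
  have hL : 0 < Real.log 2 := Real.log_pos (by norm_num)
  obtain ⟨C₁, hC₁⟩ : ∃ C, C = lam₃ - lam₁ := ⟨_, rfl⟩
  obtain ⟨C₂, hC₂⟩ : ∃ C, C = lam₃ + lam₄ - lam₁ := ⟨_, rfl⟩
  obtain ⟨C₃, hC₃⟩ : ∃ C, C = -lam₅ := ⟨_, rfl⟩
  obtain ⟨K, hK⟩ : ∃ K, K = C₁ * (t18m p₁ - t18m p₄) + C₂ * (t18m p₄ - t18m p₂)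
    + C₃ * (t18m p₂ - t18m p₅) := ⟨_, rfl⟩
  obtain ⟨G, hG⟩ : ∃ G : ℝ → ℝ, G = fun q => t18c C₁ C₂ C₃ (t18s p₁) (t18s p₄) (t18s p₂) (t18s p₅)
    (fun s => t18g s q) + K := ⟨_, rfl⟩
  have hdG : ∀ q, 0 < q → HasDerivAt G (t18c C₁ C₂ C₃ (t18s p₁) (t18s p₄) (t18s p₂) (t18s p₅)
      (fun s => t18g0 s q)) q := by
    intro q hq
    rw [hG]
    exact (t18_dc C₁ C₂ C₃ _ _ _ _ (g := t18g) (g' := t18g0) (fun s => t18_dg s hq)).add_const K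
  have hD : ∀ q, 0 < q → lam₃ * taup p₁ q + lam₄ * taup p₄ q + lam₅ * taup p₅ q
      - (lam₁ * taup p₁ q + lam₂ * taup p₂ q) = G q * (q / Real.log 2) := by
    intro q hq
    rw [t18_taup hp₁ (by linarith), t18_taup (by linarith) hp₂,
      t18_taup (show 0 < p₄ by linarith) (by linarith),
      t18_taup (show 0 < p₅ by linarith) (by linarith), hG, hK, hC₁, hC₂, hC₃]
    have e2 : lam₂ = 1 - lam₁ := by linarith
    have e5 : lam₅ = 1 - lam₃ - lam₄ := by linarith
    rw [e2, e5]
    simp only [t18c, t18g]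
    field_simp
    ring
  have hz : ∀ q, 0 < q → lam₃ * taup p₁ q + lam₄ * taup p₄ q + lam₅ * taup p₅ q
      = lam₁ * taup p₁ q + lam₂ * taup p₂ q → G q = 0 := by
    intro q hq h
    have h1 := hD q hq
    rw [h, sub_self] at h1
    have : q / Real.log 2 ≠ 0 := by positivity
    rcases mul_eq_zero.1 h1.symm with h | h
    · exact h
    · exact absurd h this
  have G1 : G 1 = 0 := hz 1 one_pos (by simp [t18_taup_one])
  have Gq1 : G q₁ = 0 := hz _ (by linarith) hagree₁
  have Gq2 : G q₂ = 0 := hz _ (by linarith) hagree₂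
  obtain ⟨x, hx, hx0⟩ := exists_hasDerivAt_eq_zero hq₁
    (fun z hz => (hdG z (by linarith [hz.1])).continuousAt.continuousWithinAt) (G1.trans Gq1.symm)
    (fun z hz => hdG z (by linarith [hz.1]))
  obtain ⟨y, hy, hy0⟩ := exists_hasDerivAt_eq_zero hq₁₂
    (fun z hz => (hdG z (by linarith [hz.1])).continuousAt.continuousWithinAt) (Gq1.trans Gq2.symm)
    (fun z hz => hdG z (by linarith [hz.1]))
  obtain ⟨hx1, hx2⟩ := hx
  obtain ⟨hy1, hy2⟩ := hy
  obtain ⟨m1, m2, m3⟩ := t18_main s5 s52 s24 s41 (show C₁ < C₂ by linarith) (show C₃ < 0 by linarith)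
    (show 0 < x by linarith) (show x < y by linarith) hx0 hy0
  have d1 : ∀ u v, 0 < u → u < v → v ≤ x → G v < G u := fun u v hu huv hv =>
    t18_dec huv (fun z h _ => hdG z (by linarith)) (fun z h h' => m1 z (by linarith) (by linarith))
  have d2 : ∀ u v, x ≤ u → u < v → v ≤ y → G u < G v := fun u v hu huv hv =>
    t18_inc huv (fun z h _ => hdG z (by linarith)) (fun z h h' => m2 z (by linarith) (by linarith))
  have d3 : ∀ u v, y ≤ u → u < v → G v < G u := fun u v hu huv =>
    t18_dec huv (fun z h _ => hdG z (by linarith)) (fun z h h' => m3 z (by linarith))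
  have hq0 : 0 < q := by linarith
  have hfac : 0 < q / Real.log 2 := by positivity
  have hiff : (lam₁ * taup p₁ q + lam₂ * taup p₂ q
          < lam₃ * taup p₁ q + lam₄ * taup p₄ q + lam₅ * taup p₅ q) ↔ 0 < G q := by
    rw [← sub_pos, hD q hq0]
    exact mul_pos_iff_of_pos_right hfac
  rw [hiff]
  constructor
  · intro hpos
    refine ⟨?_, ?_⟩
    · by_contra hc
      have hc := not_lt.1 hc
      rcases le_total q x with h | h
      · have := d1 1 q one_pos hq h
        linarith
      · rcases hc.lt_or_eq with h' | h'
        · have := d2 q q₁ h h' hy1.le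
          linarith
        · rw [h'] at hpos
          linarith
    · by_contra hc
      have hc := not_lt.1 hc
      rcases hc.lt_or_eq with h' | h'
      · have := d3 q₂ q hy2.le h'
        linarith
      · rw [← h'] at hpos
        linarith
  · rintro ⟨ha, hb⟩
    rcases le_total q y with h | h
    · have := d2 q₁ q hx2.le ha h
      linarith
    · have := d3 q q₂ h hb
      linarith
end
end
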